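/- A Brouwer homeomorphism (fixed point free, orientation preserving homeomorphism of the plane) has no periodic points: for every x ∈ ℝ² and every integer n ≠ 0, f^n(x) ≠ x. -/

import Mathlib

/-- A homeomorphism of a space is orientation preserving if it is isotopic to the identity
(a standard characterization for homeomorphisms of the plane). -/
def OrientationPreserving {X : Type*} [TopologicalSpace X] (f : X ≃ₜ X) : Prop :=
  ∃ F : ℝ → X ≃ₜ X, (Continuous fun p : ℝ × X => F p.1 p.2) ∧
    F 0 = Homeomorph.refl X ∧ F 1 = f

namespace OrientationPreserving

theorem trans {X : Type*} [TopologicalSpace X] {f g : X ≃ₜ X} (hf : OrientationPreserving f)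
    (hg : OrientationPreserving g) : OrientationPreserving (f.trans g) := by
  obtain ⟨F, hFc, hF0, hF1⟩ := hf
  obtain ⟨G, hGc, hG0, hG1⟩ := hg
  refine ⟨fun t => (F t).trans (G t), ?_, ?_, ?_⟩
  · exact hGc.comp (continuous_fst.prodMk hFc)
  · simp only [hF0, hG0]
    rfl
  · simp only [hF1, hG1]

end OrientationPreserving

/-- A nowhere vanishing continuous function on a real normed space has a continuous logarithm. -/
theorem exists_continuous_exp_eq {E : Type*} [NormedAddCommGroup E] [NormedSpace ℝ E]
    {g : E → ℂ} (hg : Continuous g) (h0 : ∀ x, g x ≠ 0) :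
    ∃ L : E → ℂ, Continuous L ∧ ∀ x, Complex.exp (L x) = g x := by
  obtain ⟨L, ⟨-, hL⟩, -⟩ := Complex.isCoveringMapOn_exp.existsUnique_continuousMap_lifts
    (⟨g, hg⟩ : C(E, ℂ)) (a₀ := 0) (Complex.exp_log (h0 0)) h0
  exact ⟨L, L.continuous, fun x => congrFun hL x⟩

/-- Two continuous logarithms of the same function have the same variation. -/
theorem sub_eq_sub_of_exp_eq {E : Type*} [TopologicalSpace E] [PreconnectedSpace E]
    {L M : E → ℂ} (hL : Continuous L) (hM : Continuous M)
    (h : ∀ x, Complex.exp (L x) = Complex.exp (M x)) (a b : E) : L b - L a = M b - M a := by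
  have key : ∀ x, ∃ n : ℤ, (L x - M x) / (2 * Real.pi * Complex.I) = n := fun x => by
    obtain ⟨n, hn⟩ := Complex.exp_eq_exp_iff_exists_int.1 (h x)
    refine ⟨n, ?_⟩
    rw [div_eq_iff Complex.two_pi_I_ne_zero, hn]
    ring
  choose n hn using key
  have hc : Continuous n := by
    rw [Int.isClosedEmbedding_coe_real.isEmbedding.continuous_iff]
    have : ((↑) ∘ n : E → ℝ) = fun x => ((L x - M x) / (2 * Real.pi * Complex.I)).re :=
      funext fun x => by simp [hn x]
    rw [this]
    fun_prop
  have hab : n a = n b := PreconnectedSpace.constant inferInstance hc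
  have := (hn a).trans ((congrArg _ hab).trans (hn b).symm)
  rw [div_left_inj' Complex.two_pi_I_ne_zero] at this
  linear_combination -this

/-- A Brouwer homeomorphism has no point of period two. -/
theorem OrientationPreserving.apply_apply_ne {f : ℂ ≃ₜ ℂ} (hor : OrientationPreserving f)
    (hfree : ∀ x, f x ≠ x) (x : ℂ) : f (f x) ≠ x := by
  intro hx
  obtain ⟨F, hFc, hF0, hF1⟩ := hor
  have hFc' : ∀ {α : Type} [TopologicalSpace α] {t : α → ℝ} {z : α → ℂ}, Continuous t →
      Continuous z → Continuous fun a => F (t a) (z a) := fun ht hz => hFc.comp (ht.prodMk hz)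
  obtain ⟨φ, hφ, hφe⟩ := exists_continuous_exp_eq (g := fun z => f z - z)
    (f.continuous.sub continuous_id) fun z => sub_ne_zero.2 (hfree z)
  let γ : ℝ → ℂ := fun s => AffineMap.lineMap x (f x) s
  have hγ : Continuous γ := AffineMap.lineMap_continuous
  have hγ0 : γ 0 = x := AffineMap.lineMap_apply_zero _ _
  have hγ1 : γ 1 = f x := AffineMap.lineMap_apply_one _ _
  obtain ⟨L, hL, hLe⟩ := exists_continuous_exp_eq
    (g := fun p : ℝ × ℝ => F p.1 (f (γ p.2)) - F p.1 (γ p.2))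
    ((hFc' continuous_fst (f.continuous.comp (hγ.comp continuous_snd))).sub
      (hFc' continuous_fst (hγ.comp continuous_snd)))
    fun p => sub_ne_zero.2 fun h => hfree _ ((F p.1).injective h)
  have hvar0 : L (0, 1) - L (0, 0) = φ (f x) - φ x := by
    have := sub_eq_sub_of_exp_eq (L := fun s : ℝ => L (0, s)) (M := fun s => φ (γ s))
      (by fun_prop) (by fun_prop) (fun s => by simp [hLe, hφe, hF0]) 0 1
    simpa [hγ0, hγ1] using this
  have hvar1 : L (1, 1) - L (1, 0) = φ x - φ (f x) := by
    have := sub_eq_sub_of_exp_eq (L := fun s : ℝ => L (1, s)) (M := fun s => φ (f (γ s)))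
      (by fun_prop) (by fun_prop) (fun s => by simp [hLe, hφe, hF1]) 0 1
    simpa [hγ0, hγ1, hx] using this
  have hends : L (1, 1) - L (0, 1) = L (1, 0) - L (0, 0) := by
    have := sub_eq_sub_of_exp_eq (L := fun t : ℝ => L (t, 1))
      (M := fun t => L (t, 0) + Real.pi * Complex.I)
      (by fun_prop) (by fun_prop)
      (fun t => by rw [Complex.exp_add, Complex.exp_pi_mul_I, hLe, hLe]; simp [hγ0, hγ1, hx]) 0 1
    simpa using this
  have heq : φ (f x) = φ x := by linear_combination (hvar1 - hvar0 - hends) / 2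
  have h1 := hφe (f x)
  rw [heq, hφe x, hx] at h1
  exact hfree x (by linear_combination h1 / 2)

/-- A point can be pushed to a nearby one by a homeomorphism supported in a ball. -/
theorem exists_homeomorph_apply_eq_of_mem_ball {c a : ℂ} {r : ℝ} (ha : a ∈ Metric.ball c r) :
    ∃ h : ℂ ≃ₜ ℂ, OrientationPreserving h ∧ (∀ z ∉ Metric.ball c r, h z = z) ∧ h c = a := by
  have hr : 0 < r := Metric.pos_of_mem_ball ha
  let ρ : ℂ → ℝ := fun z => max 0 (1 - dist z c / r)
  have hρc : Continuous ρ := by fun_prop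
  have hρ : ∀ z w, |ρ z - ρ w| ≤ ‖z - w‖ / r := fun z w => by
    refine (abs_max_sub_max_le_max _ _ _ _).trans ?_
    rw [sub_self, abs_zero, max_eq_right (abs_nonneg _)]
    have : 1 - dist z c / r - (1 - dist w c / r) = (dist w c - dist z c) / r := by ring
    rw [this, abs_div, abs_of_pos hr]
    gcongr
    rw [← dist_eq_norm, dist_comm z w]
    exact abs_dist_sub_le _ _ _
  let T : ℝ → ℝ := fun t => Set.projIcc 0 1 zero_le_one t
  have hTc : Continuous T := continuous_subtype_val.comp continuous_projIcc
  have hT : ∀ t, 0 ≤ T t ∧ T t ≤ 1 := fun t => (Set.projIcc 0 1 zero_le_one t).2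
  let k : NNReal := ⟨‖a - c‖ / r, by positivity⟩
  have hk : k < 1 := by
    rw [← NNReal.coe_lt_coe]
    change ‖a - c‖ / r < 1
    rw [div_lt_one hr, ← dist_eq_norm]
    exact ha
  let G : ℝ → ℂ → ℂ := fun t z => z + ((T t * ρ z : ℝ) : ℂ) * (a - c)
  have hG : ∀ t, ApproximatesLinearOn (G t) (ContinuousLinearEquiv.refl ℝ ℂ : ℂ →L[ℝ] ℂ)
      Set.univ k := by
    intro t z _ w _
    have : G t z - G t w - (ContinuousLinearEquiv.refl ℝ ℂ : ℂ →L[ℝ] ℂ) (z - w)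
        = ((T t * (ρ z - ρ w) : ℝ) : ℂ) * (a - c) := by
      simp only [G, ContinuousLinearEquiv.coe_coe, ContinuousLinearEquiv.refl_apply]
      push_cast
      ring
    rw [this, norm_mul, Complex.norm_real, Real.norm_eq_abs, abs_mul, abs_of_nonneg (hT t).1]
    calc T t * |ρ z - ρ w| * ‖a - c‖ ≤ 1 * (‖z - w‖ / r) * ‖a - c‖ := by
          gcongr
          exacts [(hT t).2, hρ z w]
      _ = (k : ℝ) * ‖z - w‖ := by
          change _ = ‖a - c‖ / r * ‖z - w‖
          ring
  have hk' : k < ‖((ContinuousLinearEquiv.refl ℝ ℂ).symm : ℂ →L[ℝ] ℂ)‖₊⁻¹ := by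
    have : ‖((ContinuousLinearEquiv.refl ℝ ℂ).symm : ℂ →L[ℝ] ℂ)‖₊ = 1 :=
      ContinuousLinearMap.nnnorm_id
    rw [this, inv_one]
    exact hk
  let H : ℝ → ℂ ≃ₜ ℂ := fun t => (hG t).toHomeomorph (G t) (Or.inr hk')
  have hH : ∀ t z, H t z = G t z := fun _ _ => rfl
  have hT0 : T 0 = 0 := by simp [T]
  have hT1 : T 1 = 1 := by simp [T]
  refine ⟨H 1, ⟨H, ?_, ?_, rfl⟩, fun z hz => ?_, ?_⟩
  · simp only [hH, G]
    fun_prop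
  · ext z
    simp [hH, G, hT0]
  · have : ρ z = 0 := by
      rw [Metric.mem_ball, not_lt] at hz
      refine max_eq_left ?_
      rw [sub_nonpos, one_le_div hr]
      exact hz
    simp [hH, G, this]
  · simp [hH, G, hT1, ρ]

/-- The homeomorphisms supported in a connected open set act transitively on it. -/
theorem IsPreconnected.exists_homeomorph_apply_eq {U : Set ℂ} (hU : IsPreconnected U)
    (hUo : IsOpen U) {p q : ℂ} (hp : p ∈ U) (hq : q ∈ U) :
    ∃ h : ℂ ≃ₜ ℂ, OrientationPreserving h ∧ (∀ z ∉ U, h z = z) ∧ h p = q := by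
  refine hU.induction₂' (fun p q => ∃ h : ℂ ≃ₜ ℂ, OrientationPreserving h ∧
    (∀ z ∉ U, h z = z) ∧ h p = q) ?_ ?_ hp hq
  · intro c hc
    obtain ⟨ε, hε, hball⟩ := Metric.isOpen_iff.1 hUo c hc
    filter_upwards [mem_nhdsWithin_of_mem_nhds (Metric.ball_mem_nhds c (half_pos hε))] with a ha
    constructor
    · obtain ⟨h, hor, hs, hca⟩ := exists_homeomorph_apply_eq_of_mem_ball ha
      exact ⟨h, hor, fun z hz => hs z fun hz' =>
        hz (hball (Metric.ball_subset_ball (half_le_self hε.le) hz')), hca⟩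
    · obtain ⟨h, hor, hs, hca⟩ := exists_homeomorph_apply_eq_of_mem_ball (Metric.mem_ball_comm.1 ha)
      refine ⟨h, hor, fun z hz => hs z fun hz' => hz (hball ?_), hca⟩
      rw [Metric.mem_ball] at *
      linarith [dist_triangle z a c]
  · rintro x y z - - - ⟨g, hgo, hg, rfl⟩ ⟨h, hho, hh, rfl⟩
    exact ⟨g.trans h, hgo.trans hho, fun w hw => by simp [hg w hw, hh w hw], rfl⟩

/-- Modifying a map inside a set disjoint from its image creates no fixed point. -/
theorem trans_apply_ne_of_free {f h : ℂ ≃ₜ ℂ} (hfree : ∀ x, f x ≠ x) {U : Set ℂ}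
    (hU : ∀ x ∈ U, f x ∉ U) (hh : ∀ z ∉ U, h z = z) (x : ℂ) : f.trans h x ≠ x := by
  intro hx
  rw [Homeomorph.trans_apply] at hx
  by_cases hfx : f x ∈ U
  · have hxU : x ∈ U := by
      by_contra hxU
      have := h.injective (hx.trans (hh x hxU).symm)
      exact hxU (this ▸ hfx)
    exact hU x hxU hfx
  · exact hfree x ((hh _ hfx).symm.trans hx)

/-- No orientation preserving homeomorphism of the plane without fixed points
has a point of period dividing `n`. -/
def NoPeriod (n : ℕ) : Prop :=
  ∀ f : ℂ ≃ₜ ℂ, OrientationPreserving f → (∀ x, f x ≠ x) → ∀ x, f^[n] x ≠ x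

/-- If short periods are impossible, then a free connected open set has no short returns. -/
theorem iterate_notMem_of_free {n : ℕ} (hn : ∀ m, 1 ≤ m → m < n → NoPeriod m) {f : ℂ ≃ₜ ℂ}
    (hor : OrientationPreserving f) (hfree : ∀ x, f x ≠ x) {U : Set ℂ} (hUc : IsPreconnected U)
    (hUo : IsOpen U) (hU : ∀ x ∈ U, f x ∉ U) {w : ℂ} (hw : w ∈ U) {j : ℕ} (hj : 1 ≤ j)
    (hjn : j < n) : f^[j] w ∉ U := by
  intro hmem
  classical
  have hex : ∃ i, 1 ≤ i ∧ f^[i] w ∈ U := ⟨j, hj, hmem⟩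
  obtain ⟨hi, hiU⟩ := Nat.find_spec hex
  have hin : Nat.find hex < n := (Nat.find_min' hex ⟨hj, hmem⟩).trans_lt hjn
  have hmin : ∀ k, 1 ≤ k → k < Nat.find hex → f^[k] w ∉ U :=
    fun k hk hki hkU => Nat.find_min hex hki ⟨hk, hkU⟩
  generalize Nat.find hex = i at *
  obtain ⟨h, hho, hh, hhw⟩ := hUc.exists_homeomorph_apply_eq hUo hiU hw
  have hiter : ∀ k, k < i → (f.trans h)^[k] w = f^[k] w := by
    intro k
    induction k with
    | zero => simp
    | succ k ih =>
      intro hk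
      rw [Function.iterate_succ_apply', ih (by omega), Homeomorph.trans_apply,
        ← Function.iterate_succ_apply' f, hh _ (hmin _ (by omega) hk)]
  obtain ⟨k, rfl⟩ : ∃ k, i = k + 1 := ⟨i - 1, by omega⟩
  refine hn (k + 1) hi hin (f.trans h) (hor.trans hho) (trans_apply_ne_of_free hfree hU hh) w ?_
  rw [Function.iterate_succ_apply', hiter k (by omega), Homeomorph.trans_apply,
    ← Function.iterate_succ_apply' f, hhw]

open Filter Topology in
/-- If a continuous map sends a compact set off another one,
it does so for their small thickenings. -/
theorem eventually_thickening_notMem {K L : Set ℂ} (hK : IsCompact K) (hL : IsCompact L)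
    {g : ℂ → ℂ} (hg : Continuous g) (h : ∀ x ∈ K, g x ∉ L) :
    ∀ᶠ δ in 𝓝[>] (0 : ℝ), ∀ x ∈ Metric.thickening δ K, g x ∉ Metric.thickening δ L := by
  have hsep : SeparatedNhds (g '' K) L := SeparatedNhds.of_isCompact_isCompact (hK.image hg) hL
    (Set.disjoint_left.2 (by rintro _ ⟨x, hx, rfl⟩; exact h x hx))
  obtain ⟨V, W, hV, hW, hKV, hLW, hVW⟩ := hsep
  obtain ⟨a, ha, haV⟩ := hK.exists_thickening_subset_open (hV.preimage hg)
    (Set.image_subset_iff.1 hKV)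
  obtain ⟨b, hb, hbW⟩ := hL.exists_thickening_subset_open hW hLW
  filter_upwards [Ioo_mem_nhdsGT (lt_min ha hb)] with δ hδ x hx hgx
  refine Set.disjoint_left.1 hVW (haV (Metric.thickening_mono ?_ _ hx))
    (hbW (Metric.thickening_mono ?_ _ hgx))
  · exact hδ.2.le.trans (min_le_left _ _)
  · exact hδ.2.le.trans (min_le_right _ _)

/-- Around every point there is a free open disc whose closure meets its image. -/
theorem exists_critical_ball {f : ℂ ≃ₜ ℂ} (hfree : ∀ x, f x ≠ x) (c : ℂ) :
    ∃ r > 0, ∃ z ∈ Metric.closedBall c r, f z ∈ Metric.closedBall c r ∧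
      ∀ w ∈ Metric.ball c r, f w ∉ Metric.ball c r := by
  obtain ⟨z, hz⟩ := Continuous.exists_forall_le (f := fun z : ℂ => max (dist z c) (dist (f z) c))
    (by fun_prop) (Filter.tendsto_atTop_mono (fun z => le_max_left _ _)
      (tendsto_dist_right_cocompact_atTop c))
  refine ⟨max (dist z c) (dist (f z) c), ?_, z, ?_, ?_, ?_⟩
  · by_contra hneg
    have h := not_lt.1 hneg
    have h1 := dist_le_zero.1 ((le_max_left _ _).trans h)
    have h2 := dist_le_zero.1 ((le_max_right _ _).trans h)
    exact hfree z (h2.trans h1.symm)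
  · exact le_max_left (dist z c) _
  · exact le_max_right _ (dist (f z) c)
  · intro w hw hfw
    exact (max_lt hw hfw).not_ge (hz w)

/-- A segment from the centre of a ball to a point of the closed ball stays in the open ball,
except possibly at its end. -/
theorem mem_ball_or_eq_of_mem_segment {c z w : ℂ} {r : ℝ} (hr : 0 < r)
    (hz : z ∈ Metric.closedBall c r) (hw : w ∈ segment ℝ c z) : w ∈ Metric.ball c r ∨ w = z := by
  rw [segment_eq_image_lineMap] at hw
  obtain ⟨t, ⟨ht0, ht1⟩, rfl⟩ := hw
  rcases ht1.lt_or_eq with ht | rfl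
  · left
    rw [Metric.mem_ball, dist_lineMap_left, Real.norm_eq_abs, abs_of_nonneg ht0, dist_comm]
    rw [Metric.mem_closedBall] at hz
    nlinarith [dist_nonneg (x := z) (y := c)]
  · right
    simp

theorem isCompact_segment (a b : ℂ) : IsCompact (segment ℝ a b) := by
  rw [segment_eq_image_lineMap]
  exact isCompact_Icc.image AffineMap.lineMap_continuous

/-- If shorter periods are impossible, so is `n ≥ 3`: closing up an orbit of period `n` along
a translation arc produces a homeomorphism with a point of period `n - 1`. -/
theorem noPeriod_of_lt {n : ℕ} (h3 : 3 ≤ n) (hn : ∀ m, 1 ≤ m → m < n → NoPeriod m) :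
    NoPeriod n := by
  intro f hor hfree x hx
  obtain ⟨r, hr, z, hz, hp, hB⟩ := exists_critical_ball hfree x
  have hreturn := @iterate_notMem_of_free n hn f hor hfree
  have hBret : ∀ {w j}, w ∈ Metric.ball x r → 1 ≤ j → j < n → f^[j] w ∉ Metric.ball x r :=
    fun hw => hreturn (convex_ball x r).isPreconnected Metric.isOpen_ball hB hw
  have hcl : closure (Metric.ball x r) = Metric.closedBall x r := closure_ball x hr.ne'
  have hB1 : ∀ w ∈ Metric.ball x r, f w ∉ Metric.closedBall x r := by
    intro w hw hfw
    have hd : Disjoint (f '' Metric.ball x r) (closure (Metric.ball x r)) :=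
      Disjoint.closure_right (Set.disjoint_left.2 (by rintro _ ⟨v, hv, rfl⟩; exact hB v hv))
        (f.isOpenMap _ Metric.isOpen_ball)
    exact Set.disjoint_left.1 hd ⟨w, hw, rfl⟩ (hcl ▸ hfw)
  have hB2 : ∀ w ∈ Metric.closedBall x r, f w ∉ Metric.ball x r := by
    intro w hw hfw
    have hd : Disjoint (closure (Metric.ball x r)) (f ⁻¹' Metric.ball x r) :=
      Disjoint.closure_left (Set.disjoint_left.2 hB) (Metric.isOpen_ball.preimage f.continuous)
    exact Set.disjoint_left.1 hd (hcl ▸ hw) hfw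
  have hpB : f z ∉ Metric.ball x r := hB2 z hz
  have hfpB : f (f z) ∉ Metric.ball x r := hB2 _ hp
  have hK0 := fun w => mem_ball_or_eq_of_mem_segment (w := w) hr hz
  have hK1 := fun w => mem_ball_or_eq_of_mem_segment (w := w) hr hp
  have free0 : ∀ w ∈ segment ℝ x z, f w ∉ segment ℝ x z := by
    intro w hw hfw
    rcases hK0 _ hw with hw | rfl <;> rcases hK0 _ hfw with hfw | hfw
    · exact hB w hw hfw
    · exact hB1 w hw (hfw ▸ hz)
    · exact hpB hfw
    · exact hfree _ hfw
  have free1 : ∀ w ∈ segment ℝ x (f z), f w ∉ segment ℝ x (f z) := by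
    intro w hw hfw
    rcases hK1 _ hw with hw | rfl <;> rcases hK1 _ hfw with hfw | hfw
    · exact hB w hw hfw
    · exact hB1 w hw (hfw ▸ hp)
    · exact hfpB hfw
    · exact hfree _ hfw
  have free2 : ∀ w ∈ segment ℝ x z, f (f w) ∉ segment ℝ x (f z) := by
    intro w hw hfw
    rcases hK0 _ hw with hw | rfl <;> rcases hK1 _ hfw with hfw | hfw
    · exact hBret hw (j := 2) (by omega) (by omega) hfw
    · exact hB1 w hw (f.injective hfw ▸ hz)
    · exact hfpB hfw
    · exact hfree _ hfw
  have ev := fun y w (g : ℂ → ℂ) => eventually_thickening_notMem (isCompact_segment x y)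
    (isCompact_segment x w) (g := g)
  obtain ⟨δ, ⟨⟨⟨hfree0, hfree1⟩, hfree2⟩, hδ⟩⟩ :=
    ((((ev z z f f.continuous free0).and (ev (f z) (f z) f f.continuous free1)).and
      (ev z (f z) (fun w => f (f w)) (f.continuous.comp f.continuous)
        free2)).and self_mem_nhdsWithin).exists
  set N₀ := Metric.thickening δ (segment ℝ x z)
  set N₁ := Metric.thickening δ (segment ℝ x (f z))
  have hN₀c : IsPreconnected N₀ := ((convex_segment x z).thickening δ).isPreconnected
  have hN₁c : IsPreconnected N₁ := ((convex_segment x (f z)).thickening δ).isPreconnected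
  have hN₀o : IsOpen N₀ := Metric.isOpen_thickening
  have hN₁o : IsOpen N₁ := Metric.isOpen_thickening
  have hsub := fun s : Set ℂ => Metric.self_subset_thickening hδ s
  have hx0 : x ∈ N₀ := hsub _ (left_mem_segment ℝ x z)
  have hz0 : z ∈ N₀ := hsub _ (right_mem_segment ℝ x z)
  have hx1 : x ∈ N₁ := hsub _ (left_mem_segment ℝ x (f z))
  have hz1 : f z ∈ N₁ := hsub _ (right_mem_segment ℝ x (f z))
  obtain ⟨h₁, hor₁, hs₁, hxz⟩ := hN₁c.exists_homeomorph_apply_eq hN₁o hx1 hz1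
  obtain ⟨h₂, hor₂, hs₂, hzx⟩ := (hN₀c.image f f.continuous.continuousOn).exists_homeomorph_apply_eq
    (f.isOpenMap _ hN₀o) (Set.mem_image_of_mem f hz0) (Set.mem_image_of_mem f hx0)
  have hgfree : ∀ w, (f.trans h₁).trans h₂ w ≠ w := by
    refine trans_apply_ne_of_free (trans_apply_ne_of_free hfree hfree1 hs₁) ?_ hs₂
    rintro _ ⟨u, hu, rfl⟩ ⟨v, hv, hvu⟩
    rw [Homeomorph.trans_apply, hs₁ _ (hfree2 u hu)] at hvu
    exact hfree0 u hu (f.injective hvu ▸ hv)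
  have hiter : ∀ i, i + 1 < n → ((f.trans h₁).trans h₂)^[i] (f x) = f^[i + 1] x := by
    intro i
    induction i with
    | zero => simp
    | succ i ih =>
      intro hi
      have hi0 : f^[i + 2] x ∉ f '' N₀ := by
        rintro ⟨u, hu, hux⟩
        rw [Function.iterate_succ_apply'] at hux
        exact hreturn hN₀c hN₀o hfree0 hx0 (j := i + 1) (by omega) (by omega)
          (f.injective hux ▸ hu)
      have hi1 : f^[i + 2] x ∉ N₁ := hreturn hN₁c hN₁o hfree1 hx1 (by omega) hi
      rw [Function.iterate_succ_apply', ih (by omega), Homeomorph.trans_apply,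
        Homeomorph.trans_apply, ← Function.iterate_succ_apply' f, hs₁ _ hi1, hs₂ _ hi0]
  obtain ⟨k, rfl⟩ : ∃ k, n = k + 2 := ⟨n - 2, by omega⟩
  refine hn (k + 1) (by omega) (by omega) _ ((hor.trans hor₁).trans hor₂) hgfree (f x) ?_
  rw [Function.iterate_succ_apply', hiter k (by omega), Homeomorph.trans_apply,
    Homeomorph.trans_apply, ← Function.iterate_succ_apply' f, hx, hxz, hzx]

/-- Brouwer's lemma for positive iterates. -/
theorem noPeriod {n : ℕ} (hn : 1 ≤ n) : NoPeriod n := by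
  induction n using Nat.strong_induction_on with
  | _ n ih =>
    obtain rfl | rfl | h3 : n = 1 ∨ n = 2 ∨ 3 ≤ n := by omega
    · exact fun f _ hfree x => hfree x
    · exact fun f hor hfree x => hor.apply_apply_ne hfree x
    · exact noPeriod_of_lt h3 fun m hm hmn => ih m hmn hm

/-- A Brouwer homeomorphism (fixed point free, orientation preserving homeomorphism of the
plane) has no periodic points. -/
theorem stmt_1 (f : ℂ ≃ₜ ℂ) (hor : OrientationPreserving f)
    (hfree : ∀ x : ℂ, f x ≠ x) :
    ∀ (x : ℂ) (n : ℤ), n ≠ 0 → (f.toEquiv ^ n) x ≠ x := by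
  have hpos : ∀ m : ℕ, 1 ≤ m → ∀ x, (f.toEquiv ^ m) x ≠ x := fun m hm x => by
    rw [← Equiv.Perm.iterate_eq_pow]
    exact noPeriod hm f hor hfree x
  intro x n hn hx
  obtain ⟨m, rfl | rfl⟩ := n.eq_nat_or_neg
  · exact hpos m (by omega) x (by simpa using hx)
  · refine hpos m (by omega) x ?_
    rw [zpow_neg, zpow_natCast, Equiv.Perm.inv_eq_iff_eq] at hx
    exact hx.symm
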